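/- Suppose every user k ≠ 1 reports truthfully and user 1 reports arbitrary demands d̂_1^t ≥ 0 (possibly over- and under-reporting), both runs starting from zero cumulative allocations. Then for every horizon T, user 1's total useful allocation under the deviation is at most 1.5 times its truthful total useful allocation: Û_1^T ≤ (3/2)·U_1^T. -/

import Mathlib

open Finset

/-- One step of the Karma algorithm with instantaneous guarantee `α = 0`
(assuming no user runs out of credits): from prior cumulative allocations `R`
and reported demands `d`, each user `k` is allocated
`r k = min (d k) ((lam - R k)⁺)`, where the water level `lam ≥ 0` is such that
`∑ k, r k = min C (∑ k, d k)`. -/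
def KarmaStep (n : ℕ) (C : ℝ) (R d r : Fin n → ℝ) : Prop :=
  ∃ lam : ℝ, 0 ≤ lam ∧ (∀ k, r k = min (d k) (max (lam - R k) 0)) ∧
    (∑ k, r k) = min C (∑ k, d k)

/-- Cumulative allocation of user `k` before quantum `t` (quanta are 0-based):
`cum n r t k = ∑_{τ < t} r τ k`. -/
def cum (n : ℕ) (r : ℕ → Fin n → ℝ) (t : ℕ) (k : Fin n) : ℝ :=
  ∑ τ ∈ Finset.range t, r τ k

/-- A run of the Karma algorithm over quanta `0, 1, 2, …` with reported
demands `d t` and allocations `r t`, starting from zero cumulative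
allocations. -/
def KarmaRun (n : ℕ) (C : ℝ) (d r : ℕ → Fin n → ℝ) : Prop :=
  ∀ t, KarmaStep n C (cum n r t) (d t) (r t)

/-- The map from the prior cumulative allocation to the new one is monotone in the water level:
a lower level in the second run does not increase the positive part of the difference. -/
theorem posPart_diff_le_of_level_le {lam lamh R Rh d r rh : ℝ} (hd : 0 ≤ d)
    (hr : r = min d (max (lam - R) 0)) (hrh : rh = min d (max (lamh - Rh) 0))
    (hl : lamh ≤ lam) : max (Rh + rh - (R + r)) 0 ≤ max (Rh - R) 0 := by
  grind

/-- A higher level in the second run does not increase the negative part of the difference of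
cumulative allocations. -/
theorem posPart_diff_le_of_le_level {lam lamh R Rh d r rh : ℝ} (hd : 0 ≤ d)
    (hr : r = min d (max (lam - R) 0)) (hrh : rh = min d (max (lamh - Rh) 0))
    (hl : lam ≤ lamh) : max (Rh + rh - (R + r)) 0 ≤ max (Rh - R) 0 + (rh - r) := by
  grind

/-- If the positive part of the difference strictly decreases although the second level is higher,
then the remaining difference is at least the gap between the levels. -/
theorem level_gap_le_of_posPart_diff_lt {lam lamh R Rh d r rh : ℝ}
    (hr : r = min d (max (lam - R) 0)) (hrh : rh = min d (max (lamh - Rh) 0))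
    (hd : 0 ≤ d)
    (hlt : max (Rh + rh - (R + r)) 0 < max (Rh - R) 0) :
    lamh - lam ≤ max (Rh + rh - (R + r)) 0 := by
  have h1 : rh < r := by
    by_contra! h
    have : Rh - R ≤ Rh + rh - (R + r) := by linarith
    exact absurd (max_le_max_right 0 this) (not_le.mpr hlt)
  refine le_trans ?_ (le_max_left _ _)
  grind

/-- The total excess, over users other than `u`, of the cumulative allocations `Rh` over `R`. -/
noncomputable def excess {n : ℕ} (u : Fin n) (R Rh : Fin n → ℝ) : ℝ :=
  ∑ k ∈ univ.erase u, max (Rh k - R k) 0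

section Step

variable {n : ℕ} {C : ℝ} {u : Fin n} {R Rh d dh r rh : Fin n → ℝ}

theorem KarmaStep.le_demand (h : KarmaStep n C R d r) (k : Fin n) : r k ≤ d k := by
  obtain ⟨lam, -, hr, -⟩ := h
  rw [hr k]
  exact min_le_left _ _

theorem KarmaStep.nonneg (h : KarmaStep n C R d r) (hd : ∀ k, 0 ≤ d k) (k : Fin n) :
    0 ≤ r k := by
  obtain ⟨lam, -, hr, -⟩ := h
  rw [hr k]
  exact le_min (hd k) (le_max_right _ _)

/-- If the deviating run gives the other users more than the truthful run does, this comes out of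
the truthful allocation of `u`. -/
theorem KarmaStep.sum_erase_sub_le (h : KarmaStep n C R d r) (hh : KarmaStep n C Rh dh rh)
    (hsame : ∀ k, k ≠ u → dh k = d k) :
    ∑ k ∈ univ.erase u, (rh k - r k) ≤ max (r u - rh u) 0 := by
  have hle := hh.le_demand
  have hle' := h.le_demand
  obtain ⟨-, -, -, hsum⟩ := h
  obtain ⟨-, -, -, hsumh⟩ := hh
  rcases le_total C (∑ k, d k) with hC | hC
  · rw [min_eq_left hC] at hsum
    have hsumh' : ∑ k, rh k ≤ C := hsumh.trans_le (min_le_left _ _)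
    rw [← add_sum_erase _ _ (mem_univ u)] at hsum hsumh'
    rw [sum_sub_distrib]
    exact le_max_of_le_left (by linarith)
  · rw [min_eq_right hC] at hsum
    have heq := (sum_eq_sum_iff_of_le fun k _ => hle' k).mp hsum
    refine le_max_of_le_right (sum_nonpos fun k hk => ?_)
    have := hle k
    rw [hsame k (ne_of_mem_erase hk)] at this
    linarith [heq k (mem_univ k)]

/-- When the demand of `u` is not met in the truthful run, the capacity is exhausted. -/
theorem KarmaStep.sum_erase_sub_le_of_lt (h : KarmaStep n C R d r) (hh : KarmaStep n C Rh dh rh)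
    (hlt : r u < d u) :
    ∑ k ∈ univ.erase u, (rh k - r k) ≤ r u - rh u := by
  have hle := h.le_demand
  obtain ⟨-, -, -, hsum⟩ := h
  obtain ⟨-, -, -, hsumh⟩ := hh
  have hs : ∑ k, r k < ∑ k, d k := sum_lt_sum (fun k _ => hle k) ⟨u, mem_univ u, hlt⟩
  have hC : ∑ k, r k = C := by
    rcases min_choice C (∑ k, d k) with h | h <;> linarith
  have hsumh' : ∑ k, rh k ≤ C := hsumh.trans_le (min_le_left _ _)
  rw [← add_sum_erase _ _ (mem_univ u)] at hC hsumh'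
  rw [sum_sub_distrib]
  linarith

/-- The effect of one step on the excess of the other users and on the gain `g` of user `u`. -/
theorem KarmaStep.excess_add_gain_le (h : KarmaStep n C R d r) (hh : KarmaStep n C Rh dh rh)
    (hd : ∀ k, 0 ≤ d k) (hdh : ∀ k, 0 ≤ dh k) (hsame : ∀ k, k ≠ u → dh k = d k) {g : ℝ}
    (hg : g ≤ Rh u - R u) :
    excess u (R + r) (Rh + rh) + max (g + (min (rh u) (d u) - r u)) 0
        ≤ excess u R Rh + max g 0 + r u ∧
      (min (rh u) (d u) ≤ r u ∨ g + (min (rh u) (d u) - r u) ≤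
        excess u (R + r) (Rh + rh)) := by
  have hcap := h.sum_erase_sub_le hh hsame
  have hcap' := h.sum_erase_sub_le_of_lt (u := u) hh
  have hru := h.nonneg hd u
  have hrhu := hh.nonneg hdh u
  have hP : 0 ≤ excess u (R + r) (Rh + rh) := sum_nonneg fun k _ => le_max_right _ _
  obtain ⟨lam, -, hr, -⟩ := h
  obtain ⟨lamh, -, hrh, -⟩ := hh
  have hrh' : ∀ k ∈ univ.erase u, rh k = min (d k) (max (lamh - Rh k) 0) := fun k hk => by
    rw [hrh k, hsame k (ne_of_mem_erase hk)]
  have hdown : lamh ≤ lam → excess u (R + r) (Rh + rh) ≤ excess u R Rh := fun hl =>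
    sum_le_sum fun k hk => posPart_diff_le_of_level_le (hd k) (hr k) (hrh' k hk) hl
  have hup : lam ≤ lamh → excess u (R + r) (Rh + rh) ≤
      excess u R Rh + ∑ k ∈ univ.erase u, (rh k - r k) := fun hl => by
    rw [excess, excess, ← sum_add_distrib]
    exact sum_le_sum fun k hk => posPart_diff_le_of_le_level (hd k) (hr k) (hrh' k hk) hl
  rcases le_or_gt (min (rh u) (d u)) (r u) with hle | hlt
  · refine ⟨?_, Or.inl hle⟩
    have hmax : max (g + (min (rh u) (d u) - r u)) 0 ≤ max g 0 :=
      max_le_max_right 0 (by linarith)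
    have hle' : max (r u - rh u) 0 ≤ r u := max_le (by linarith) hru
    rcases le_total lamh lam with hl | hl
    · linarith [hdown hl]
    · linarith [hup hl]
  · have hrrh : r u < rh u := hlt.trans_le (min_le_left _ _)
    have hrd : r u < d u := hlt.trans_le (min_le_right _ _)
    have hmin : min (rh u) (d u) ≤ rh u := min_le_left _ _
    have hcap := hcap' hrd
    have hgap : Rh u + rh u - (R u + r u) ≤ lamh - lam := by
      have h1 := hr u
      have h2 := hrh u
      grind
    rcases le_or_gt (g + (min (rh u) (d u) - r u)) 0 with hg0 | hg0
    · refine ⟨?_, Or.inr (hg0.trans hP)⟩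
      rw [max_eq_right hg0]
      have := le_max_right g 0
      rcases le_total lamh lam with hl | hl
      · linarith [hdown hl]
      · linarith [hup hl]
    · have hl : lam ≤ lamh := by linarith
      have hup := hup hl
      refine ⟨?_, Or.inr ?_⟩
      · rw [max_eq_left hg0.le]
        linarith [le_max_left g 0]
      · obtain ⟨k, hk, hklt⟩ : ∃ k ∈ univ.erase u,
            max ((Rh + rh) k - (R + r) k) 0 < max (Rh k - R k) 0 :=
          exists_lt_of_sum_lt (show excess u (R + r) (Rh + rh) < excess u R Rh by linarith)
        have hle := level_gap_le_of_posPart_diff_lt (hr k) (hrh' k hk) (hd k) hklt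
        have hsingle : max ((Rh + rh) k - (R + r) k) 0 ≤ excess u (R + r) (Rh + rh) :=
          single_le_sum (f := fun k => max ((Rh + rh) k - (R + r) k) 0)
            (fun _ _ => le_max_right _ _) hk
        simp only [Pi.add_apply] at hsingle
        linarith

end Step

theorem cum_succ (n : ℕ) (r : ℕ → Fin n → ℝ) (t : ℕ) :
    cum n r (t + 1) = cum n r t + r t :=
  funext fun _ => sum_range_succ _ _

/-- (Lemma 2, general form.) If every user other than `u` reports truthfully
while user `u` reports arbitrary nonnegative demands (possibly over- and
under-reporting), then for every horizon `T`, user `u`'s total useful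
allocation under the deviation is at most `3/2` times its truthful total
useful allocation. Both runs start from zero cumulative allocations. -/
theorem karma_arbitrary_deviation_at_most_three_halves (n : ℕ) (C : ℝ)
    (hC : 0 < C) (u : Fin n) (d dh r rh : ℕ → Fin n → ℝ)
    (hd : ∀ t k, 0 ≤ d t k) (hdh : ∀ t k, 0 ≤ dh t k)
    (hsame : ∀ t, ∀ k, k ≠ u → dh t k = d t k)
    (hrun : KarmaRun n C d r) (hrunh : KarmaRun n C dh rh) (T : ℕ) :
    (∑ t ∈ Finset.range T, min (rh t u) (d t u)) ≤
      (3 / 2) * (∑ t ∈ Finset.range T, min (r t u) (d t u)) := by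
  have htrue : ∑ t ∈ range T, min (r t u) (d t u) = cum n r T u :=
    sum_congr rfl fun t _ => min_eq_left ((hrun t).le_demand u)
  rw [htrue]
  have huseful (t : ℕ) : ∑ τ ∈ range t, min (rh τ u) (d τ u) ≤ cum n rh t u :=
    sum_le_sum fun _ _ => min_le_left _ _
  suffices H : ∀ t, excess u (cum n r t) (cum n rh t) +
        max (∑ τ ∈ range t, min (rh τ u) (d τ u) - cum n r t u) 0 ≤ cum n r t u ∧
      ∑ τ ∈ range t, min (rh τ u) (d τ u) ≤ 3 / 2 * cum n r t u from (H T).2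
  intro t
  induction t with
  | zero => simp [excess, cum]
  | succ t ih =>
    obtain ⟨hpot, hbound⟩ := ih
    obtain ⟨hstep, hgain⟩ := (hrun t).excess_add_gain_le (hrunh t) (hd t) (hdh t) (hsame t)
      (sub_le_sub_right (huseful t) (cum n r t u))
    have hr := (hrun t).nonneg (hd t) u
    rw [sum_range_succ, cum_succ, cum_succ, Pi.add_apply, add_sub_add_comm]
    have hpot' := hstep.trans (add_le_add_left hpot (r t u))
    refine ⟨hpot', ?_⟩
    rcases hgain with hle | hle
    · linarith
    · linarith [le_max_left (∑ τ ∈ range t, min (rh τ u) (d τ u) - cum n r t u +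
        (min (rh t u) (d t u) - r t u)) 0]
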